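/- For every integer d ≥ 3 there exists a constant C(d) > 0 such that for every N ≥ 2, the incidence matrix D_d of the d-dimensional grid graph on n = N^d vertices has inverse scaling factor ρ(D_d) ≤ C(d); that is, every column s of the Moore–Penrose pseudoinverse D_d† satisfies ‖s‖₂ ≤ C(d), uniformly in N. -/

import Mathlib

open MeasureTheory ProbabilityTheory Matrix

noncomputable section

/-- Euclidean norm of a finitely indexed real vector. -/
def norm2 {V : Type*} [Fintype V] (θ : V → ℝ) : ℝ := Real.sqrt (∑ i, θ i ^ 2)

/-- Euclidean norm of the `j`-th column of `S`. -/
def colNorm {V E : Type*} [Fintype V] (S : Matrix V E ℝ) (j : E) : ℝ :=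
  Real.sqrt (∑ i, S i j ^ 2)

/-- `D` is an (oriented) edge–vertex incidence matrix of the simple graph `G`:
each row has a `1` and a `-1` at the endpoints of an edge of `G` and `0` elsewhere,
and each edge of `G` corresponds to exactly one row. -/
def IsIncidence {V E : Type*} (G : SimpleGraph V) (D : Matrix E V ℝ) : Prop :=
  (∀ e : E, ∃ i j : V, G.Adj i j ∧ D e i = 1 ∧ D e j = -1 ∧
      ∀ k : V, k ≠ i → k ≠ j → D e k = 0) ∧
  (∀ i j : V, G.Adj i j →
      ∃! e : E, (D e i = 1 ∧ D e j = -1) ∨ (D e i = -1 ∧ D e j = 1))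

/-- `S` is the Moore–Penrose pseudoinverse of `D`. -/
def IsMoorePenrose {E V : Type*} [Fintype V] [Fintype E]
    (D : Matrix E V ℝ) (S : Matrix V E ℝ) : Prop :=
  D * S * D = D ∧ S * D * S = S ∧ (D * S)ᵀ = D * S ∧ (S * D)ᵀ = S * D

/-- Inverse scaling factor: maximal column norm of the pseudoinverse `S` of `D`. -/
def invScaling {V E : Type*} [Fintype V] (S : Matrix V E ℝ) : ℝ := ⨆ j : E, colNorm S j

/-- Compatibility factor `κ_T(D)`. -/
def compat {V E : Type*} [Fintype V] [Fintype E] [DecidableEq E]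
    (D : Matrix E V ℝ) (T : Finset E) : ℝ :=
  if T = ∅ then 1
  else sInf {r : ℝ | ∃ θ : V → ℝ, (∑ e ∈ T, |D.mulVec θ e|) ≠ 0 ∧
    r = Real.sqrt T.card * norm2 θ / ∑ e ∈ T, |D.mulVec θ e|}

/-- `θhat` is a TV denoiser with data `y` and regularization `lam`,
i.e. a minimizer of the TV-penalized least squares criterion. -/
def IsTVDenoiser {V E : Type*} [Fintype V] [Fintype E]
    (D : Matrix E V ℝ) (lam : ℝ) (y θhat : V → ℝ) : Prop :=
  ∀ θ : V → ℝ,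
    (1 / (Fintype.card V : ℝ)) * ∑ i, (θhat i - y i) ^ 2 + lam * ∑ e, |D.mulVec θhat e|
      ≤ (1 / (Fintype.card V : ℝ)) * ∑ i, (θ i - y i) ^ 2 + lam * ∑ e, |D.mulVec θ e|

/-- The law of the noise vector `ε`: independent centered Gaussian coordinates
with variance `σ²`. -/
def noise (V : Type*) [Fintype V] (σ : ℝ) : Measure (V → ℝ) :=
  Measure.pi fun _ => gaussianReal 0 (σ ^ 2).toNNReal

/-- Number of nonzero coordinates. -/
def supp0 {E : Type*} [Fintype E] (x : E → ℝ) : ℕ :=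
  (Finset.univ.filter fun e => x e ≠ 0).card

/-- The N×N two-dimensional grid graph. -/
def gridGraph2 (N : ℕ) : SimpleGraph (Fin N × Fin N) :=
  SimpleGraph.fromRel fun a b =>
    (a.1 = b.1 ∧ (a.2 : ℕ) + 1 = (b.2 : ℕ)) ∨ (a.2 = b.2 ∧ (a.1 : ℕ) + 1 = (b.1 : ℕ))

/-- The d-dimensional N×⋯×N grid graph. -/
def gridGraphD (d N : ℕ) : SimpleGraph (Fin d → Fin N) :=
  SimpleGraph.fromRel fun a b =>
    ∃ j : Fin d, ((a j : ℕ) + 1 = (b j : ℕ)) ∧ ∀ k : Fin d, k ≠ j → a k = b k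

/-- The d-dimensional hypercube graph. -/
def cubeGraph (d : ℕ) : SimpleGraph (Fin d → Bool) :=
  SimpleGraph.fromRel fun a b =>
    ∃ j : Fin d, a j ≠ b j ∧ ∀ k : Fin d, k ≠ j → a k = b k

/-- The k-th power of the cycle graph on n vertices. -/
def cyclePowerGraph (n k : ℕ) : SimpleGraph (Fin n) :=
  SimpleGraph.fromRel fun a b =>
    ∃ l : ℕ, 1 ≤ l ∧ l ≤ k ∧ (b : ℕ) = ((a : ℕ) + l) % n

/-- Orthonormal discrete cosine modes on a path with `N` vertices. -/
def cosMode (N k x : ℕ) : ℝ :=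
  √((if k = 0 then 1 else 2) / N) * Real.cos (Real.pi * k / N * (x + 1 / 2))

theorem two_mul_sin_half_mul_sum_cos (θ : ℝ) (N : ℕ) :
    2 * Real.sin (θ / 2) * ∑ x ∈ Finset.range N, Real.cos (θ * (x + 1 / 2)) =
      Real.sin (θ * N) := by
  induction N with
  | zero => simp
  | succ n ih =>
    rw [Finset.sum_range_succ, mul_add, ih]
    push_cast
    have h1 : θ * n = θ * (n + 1 / 2) - θ / 2 := by ring
    have h2 : θ * (n + 1) = θ * (n + 1 / 2) + θ / 2 := by ring
    rw [h1, h2, Real.sin_sub, Real.sin_add]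
    ring

theorem sum_cos_eq_zero {N : ℕ} (m : ℤ) (hm : m ≠ 0) (hm' : |m| < 2 * N) :
    ∑ x ∈ Finset.range N, Real.cos (Real.pi * m / N * (x + 1 / 2)) = 0 := by
  have hN : (0 : ℝ) < N := by
    have : (0 : ℤ) < N := by have := abs_nonneg m; omega
    exact_mod_cast this
  have h := two_mul_sin_half_mul_sum_cos (Real.pi * m / N) N
  rw [div_mul_cancel₀ _ hN.ne', mul_comm Real.pi, Real.sin_int_mul_pi] at h
  rw [mul_comm (m : ℝ)] at h
  refine (mul_eq_zero.mp h).resolve_left (mul_ne_zero two_ne_zero fun h0 => ?_)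
  obtain ⟨n, hn⟩ := Real.sin_eq_zero_iff.mp h0
  have hn' : (m : ℝ) = n * (2 * N) := by
    field_simp at hn
    nlinarith [hn]
  have hn'' : m = n * (2 * N) := by exact_mod_cast hn'
  exact hm (Int.eq_zero_of_abs_lt_dvd ⟨n, by rw [hn'']; ring⟩ hm')

theorem sum_cosMode_mul_cosMode {N k l : ℕ} (hk : k < N) (hl : l < N) :
    ∑ x ∈ Finset.range N, cosMode N k x * cosMode N l x = if k = l then 1 else 0 := by
  have hN : (0 : ℝ) < N := by exact_mod_cast (by omega : 0 < N)
  have key : ∑ x ∈ Finset.range N, cosMode N k x * cosMode N l x =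
      √((if k = 0 then 1 else 2) / N) * √((if l = 0 then 1 else 2) / N) / 2 *
        (∑ x ∈ Finset.range N, Real.cos (Real.pi * ((k - l : ℤ) : ℝ) / N * (x + 1 / 2)) +
          ∑ x ∈ Finset.range N, Real.cos (Real.pi * ((k + l : ℤ) : ℝ) / N * (x + 1 / 2))) := by
    rw [← Finset.sum_add_distrib, Finset.mul_sum]
    refine Finset.sum_congr rfl fun x _ => ?_
    have h1 : Real.pi * ((k - l : ℤ) : ℝ) / N * (x + 1 / 2) =
        Real.pi * k / N * (x + 1 / 2) - Real.pi * l / N * (x + 1 / 2) := by push_cast; ring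
    have h2 : Real.pi * ((k + l : ℤ) : ℝ) / N * (x + 1 / 2) =
        Real.pi * k / N * (x + 1 / 2) + Real.pi * l / N * (x + 1 / 2) := by push_cast; ring
    rw [h1, h2, Real.cos_sub, Real.cos_add, cosMode, cosMode]
    ring
  rw [key]
  by_cases hkl : k = l
  · subst hkl
    by_cases h0 : k = 0
    · subst h0
      rw [Real.mul_self_sqrt (by positivity)]
      simp
      field_simp
      norm_num
    · rw [Real.mul_self_sqrt (by positivity), sum_cos_eq_zero (k + k : ℤ) (by omega) (by
        rw [abs_of_nonneg] <;> omega)]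
      simp [h0]
      field_simp
  · rw [sum_cos_eq_zero (k - l : ℤ) (by omega) (by rw [abs_lt]; omega),
      sum_cos_eq_zero (k + l : ℤ) (by omega) (by rw [abs_lt]; omega)]
    simp [hkl]

/-- Each cosine mode is an eigenvector of the Neumann Laplacian of the path. -/
theorem sum_cosMode_sub_cosMode {N x : ℕ} (k : ℕ) (hx : x < N) :
    ∑ z ∈ Finset.range N, (if z = x + 1 ∨ x = z + 1 then cosMode N k x - cosMode N k z else 0) =
      (2 - 2 * Real.cos (Real.pi * k / N)) * cosMode N k x := by
  have hN : (N : ℝ) ≠ 0 := by exact_mod_cast (by omega : N ≠ 0)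
  have split : ∀ z, (if z = x + 1 ∨ x = z + 1 then cosMode N k x - cosMode N k z else 0) =
      (if z = x + 1 then cosMode N k x - cosMode N k z else 0) +
        (if x = z + 1 then cosMode N k x - cosMode N k z else 0) := by
    intro z
    by_cases h1 : z = x + 1
    · have h2 : x ≠ z + 1 := by omega
      rw [if_pos (Or.inl h1), if_pos h1, if_neg h2, add_zero]
    · simp [h1]
  have hright : ∑ z ∈ Finset.range N, (if z = x + 1 then cosMode N k x - cosMode N k z else 0) =
      cosMode N k x - cosMode N k (x + 1) := by
    rw [Finset.sum_ite_eq']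
    split_ifs with h
    · rfl
    · obtain rfl : N = x + 1 := by simp at h; omega
      have h1 : Real.pi * k / ((x + 1 : ℕ) : ℝ) * (x + 1 / 2) =
          k * Real.pi - Real.pi * k / ((x + 1 : ℕ) : ℝ) / 2 := by
        push_cast at hN ⊢; field_simp; ring
      have h2 : Real.pi * k / ((x + 1 : ℕ) : ℝ) * ((x + 1 : ℕ) + 1 / 2) =
          k * Real.pi + Real.pi * k / ((x + 1 : ℕ) : ℝ) / 2 := by
        push_cast at hN ⊢; field_simp
      rw [cosMode, cosMode, h1, h2, Real.cos_sub, Real.cos_add, Real.sin_nat_mul_pi]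
      ring
  have hcos (u : ℝ) : Real.cos (u - Real.pi * k / N) + Real.cos (u + Real.pi * k / N) =
      2 * Real.cos (Real.pi * k / N) * Real.cos u := by
    rw [Real.cos_sub, Real.cos_add]; ring
  rw [Finset.sum_congr rfl fun z _ => split z, Finset.sum_add_distrib, hright]
  have hu := hcos (Real.pi * k / N * (x + 1 / 2))
  have h2 : Real.pi * k / N * (x + 1 / 2) + Real.pi * k / N =
    Real.pi * k / N * ((x + 1 : ℕ) + 1 / 2) := by push_cast; ring
  rw [h2] at hu
  rcases x with _ | y
  · simp only [cosMode]
    have h1 : Real.pi * k / N * ((0 : ℕ) + 1 / 2) - Real.pi * k / N =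
      - (Real.pi * k / N * ((0 : ℕ) + 1 / 2)) := by push_cast; ring
    rw [h1, Real.cos_neg] at hu
    simp only [(Nat.succ_ne_zero _).symm, if_false, Finset.sum_const_zero]
    linear_combination (-√((if k = 0 then 1 else 2) / N)) * hu
  · have hl : ∑ z ∈ Finset.range N,
        (if y + 1 = z + 1 then cosMode N k (y + 1) - cosMode N k z else 0) =
        cosMode N k (y + 1) - cosMode N k y := by
      simp only [Nat.add_right_cancel_iff, Finset.sum_ite_eq]
      rw [if_pos (Finset.mem_range.mpr (by omega))]
    rw [hl]
    simp only [cosMode]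
    have h1 : Real.pi * k / N * ((y + 1 : ℕ) + 1 / 2) - Real.pi * k / N =
      Real.pi * k / N * (y + 1 / 2) := by push_cast; ring
    rw [h1] at hu
    linear_combination (-√((if k = 0 then 1 else 2) / N)) * hu

theorem cosMode_sq_le (N k x : ℕ) : cosMode N k x ^ 2 ≤ 2 / N := by
  rw [cosMode, mul_pow, Real.sq_sqrt (by positivity)]
  refine (mul_le_of_le_one_right (by positivity) (Real.cos_sq_le_one _)).trans ?_
  gcongr
  split_ifs <;> norm_num

theorem cosMode_sub_succ_sq_le (N k x : ℕ) :
    (cosMode N k x - cosMode N k (x + 1)) ^ 2 ≤ 2 / N * (2 - 2 * Real.cos (Real.pi * k / N)) := by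
  have h1 : Real.pi * k / N * (x + 1 / 2) =
      Real.pi * k / N * (x + 1) - Real.pi * k / N / 2 := by ring
  have h2 : Real.pi * k / N * ((x + 1 : ℕ) + 1 / 2) =
      Real.pi * k / N * (x + 1) + Real.pi * k / N / 2 := by push_cast; ring
  have h3 : 2 - 2 * Real.cos (Real.pi * k / N) = 4 * Real.sin (Real.pi * k / N / 2) ^ 2 := by
    rw [Real.sin_sq_eq_half_sub]; ring_nf
  have h4 : cosMode N k x - cosMode N k (x + 1) = √((if k = 0 then 1 else 2) / N) *
      (2 * Real.sin (Real.pi * k / N * (x + 1)) * Real.sin (Real.pi * k / N / 2)) := by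
    rw [cosMode, cosMode, h1, h2, Real.cos_sub, Real.cos_add]; ring
  rw [h4, h3, mul_pow, Real.sq_sqrt (by positivity)]
  have h5 : (2 * Real.sin (Real.pi * k / N * (x + 1)) * Real.sin (Real.pi * k / N / 2)) ^ 2 ≤
      4 * Real.sin (Real.pi * k / N / 2) ^ 2 := by
    have := mul_le_of_le_one_left (sq_nonneg (Real.sin (Real.pi * k / N / 2)))
      (Real.sin_sq_le_one (Real.pi * k / N * (x + 1)))
    nlinarith
  gcongr
  split_ifs <;> norm_num

theorem sq_le_two_sub_two_mul_cos {N k : ℕ} (hk : k < N) :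
    4 / (N : ℝ) ^ 2 * (k : ℝ) ^ 2 ≤ 2 - 2 * Real.cos (Real.pi * k / N) := by
  have hN : (0 : ℝ) < N := by exact_mod_cast (by omega : 0 < N)
  have hkN : (k : ℝ) ≤ N := by exact_mod_cast hk.le
  have hπ := Real.pi_pos
  have h3 : 2 - 2 * Real.cos (Real.pi * k / N) = 4 * Real.sin (Real.pi * k / N / 2) ^ 2 := by
    rw [Real.sin_sq_eq_half_sub]; ring_nf
  have h := Real.mul_le_sin (x := Real.pi * k / N / 2) (by positivity) (by
    gcongr
    rw [div_le_iff₀ hN]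
    gcongr)
  have h' : 2 / Real.pi * (Real.pi * k / N / 2) = k / N := by field_simp
  rw [h'] at h
  rw [h3]
  calc 4 / (N : ℝ) ^ 2 * (k : ℝ) ^ 2 = 4 * (k / N : ℝ) ^ 2 := by ring
    _ ≤ _ := by gcongr

section MoorePenrose

variable {V E : Type*} [Fintype V] [Fintype E] {D : Matrix E V ℝ} {S : Matrix V E ℝ}

theorem IsMoorePenrose.transpose_mulVec_gram (h : IsMoorePenrose D S) (v : V → ℝ) :
    Sᵀ *ᵥ ((Dᵀ * D) *ᵥ v) = D *ᵥ v := by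
  rw [mulVec_mulVec, ← Matrix.mul_assoc, ← transpose_mul, h.2.2.1, h.1]

theorem IsMoorePenrose.transpose_mulVec_eq_zero (h : IsMoorePenrose D S) {v : V → ℝ}
    (hv : D *ᵥ v = 0) : Sᵀ *ᵥ v = 0 := by
  have h1 : Sᵀ = Sᵀ * S * D := by
    conv_lhs => rw [← h.2.1, transpose_mul, h.2.2.2, ← Matrix.mul_assoc]
  rw [h1, ← mulVec_mulVec, hv, mulVec_zero]

end MoorePenrose

section Incidence

variable {V E : Type*} [Fintype V] {G : SimpleGraph V} {D : Matrix E V ℝ}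

theorem IsIncidence.exists_mulVec_eq (h : IsIncidence G D) (e : E) :
    ∃ i j : V, G.Adj i j ∧ D e i = 1 ∧ D e j = -1 ∧ (∀ k : V, k ≠ i → k ≠ j → D e k = 0) ∧
      ∀ v : V → ℝ, (D *ᵥ v) e = v i - v j := by
  classical
  obtain ⟨i, j, hij, hi, hj, h0⟩ := h.1 e
  refine ⟨i, j, hij, hi, hj, h0, fun v => ?_⟩
  rw [mulVec, dotProduct, Finset.sum_eq_add i j hij.ne]
  · rw [hi, hj]; ring
  · intro k _ hk
    rw [h0 k hk.1 hk.2, zero_mul]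
  · simp
  · simp

open Classical in
theorem IsIncidence.gram_mulVec [Fintype E] (h : IsIncidence G D) (v : V → ℝ) (x : V) :
    ((Dᵀ * D) *ᵥ v) x = ∑ y, if G.Adj x y then v x - v y else 0 := by
  have hrow (e : E) : D e x * (D *ᵥ v) e =
      ∑ y, if (D e x = 1 ∧ D e y = -1) ∨ (D e x = -1 ∧ D e y = 1) then v x - v y else 0 := by
    obtain ⟨i, j, hij, hi, hj, h0, hv⟩ := h.exists_mulVec_eq e
    rw [hv]
    by_cases hxi : x = i
    · subst hxi
      rw [Finset.sum_eq_single j]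
      · simp [hi, hj]
      · intro y _ hy
        rw [if_neg]
        rintro (⟨_, h2⟩ | ⟨h1, _⟩)
        · by_cases hyx : y = x
          · rw [hyx, hi] at h2; norm_num at h2
          · rw [h0 y hyx hy] at h2; norm_num at h2
        · rw [hi] at h1; norm_num at h1
      · simp
    · by_cases hxj : x = j
      · subst hxj
        rw [Finset.sum_eq_single i]
        · simp [hi, hj]
        · intro y _ hy
          rw [if_neg]
          rintro (⟨h1, _⟩ | ⟨_, h2⟩)
          · rw [hj] at h1; norm_num at h1
          · by_cases hyx : y = x
            · rw [hyx, hj] at h2; norm_num at h2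
            · rw [h0 y hy hyx] at h2; norm_num at h2
        · simp
      · simp [h0 x hxi hxj]
  rw [← mulVec_mulVec, mulVec, dotProduct]
  simp only [transpose_apply]
  rw [Finset.sum_congr rfl fun e _ => hrow e, Finset.sum_comm]
  refine Finset.sum_congr rfl fun y _ => ?_
  split_ifs with hxy
  · obtain ⟨e, he, hu⟩ := h.2 x y hxy
    rw [Finset.sum_eq_single e, if_pos he]
    · intro e' _ hne
      exact if_neg fun h' => hne (hu e' h')
    · simp
  · refine Finset.sum_eq_zero fun e _ => if_neg fun h' => hxy ?_
    obtain ⟨i, j, hij, hi, hj, h0, -⟩ := h.exists_mulVec_eq e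
    have hx : x = i ∨ x = j := by
      by_contra! hc
      rw [h0 x hc.1 hc.2] at h'; norm_num at h'
    have hy : y = i ∨ y = j := by
      by_contra! hc
      rw [h0 y hc.1 hc.2] at h'; norm_num at h'
    rcases hx with rfl | rfl <;> rcases hy with rfl | rfl
    · rw [hi] at h'; norm_num at h'
    · exact hij
    · exact hij.symm
    · rw [hj] at h'; norm_num at h'

end Incidence

section Grid

variable {d N : ℕ}

theorem gridGraphD_adj_iff {x y : Fin d → Fin N} :
    (gridGraphD d N).Adj x y ↔ ∃ i : Fin d, ∃ z : Fin N,
      ((z : ℕ) = x i + 1 ∨ (x i : ℕ) = z + 1) ∧ y = Function.update x i z := by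
  rw [gridGraphD, SimpleGraph.fromRel_adj]
  constructor
  · rintro ⟨-, ⟨i, h1, h2⟩ | ⟨i, h1, h2⟩⟩
    · refine ⟨i, y i, Or.inl h1.symm, ?_⟩
      rw [Function.eq_update_iff]
      exact ⟨rfl, fun k hk => (h2 k hk).symm⟩
    · refine ⟨i, y i, Or.inr h1.symm, ?_⟩
      rw [Function.eq_update_iff]
      exact ⟨rfl, fun k hk => h2 k hk⟩
  · rintro ⟨i, z, hz, rfl⟩
    refine ⟨fun h => ?_, ?_⟩
    · have := congrFun h i
      rw [Function.update_self] at this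
      rw [← this] at hz
      omega
    · rcases hz with hz | hz
      · refine Or.inl ⟨i, by simp [hz], fun k hk => by simp [hk]⟩
      · refine Or.inr ⟨i, by simp [hz], fun k hk => by simp [hk]⟩

open Classical in
theorem sum_gridGraphD_adj (x : Fin d → Fin N) (f : (Fin d → Fin N) → ℝ) :
    (∑ y, if (gridGraphD d N).Adj x y then f y else 0) =
      ∑ i, ∑ z : Fin N, if (z : ℕ) = x i + 1 ∨ (x i : ℕ) = z + 1
        then f (Function.update x i z) else 0 := by
  rw [← Fintype.sum_prod_type', ← Finset.sum_filter, ← Finset.sum_filter]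
  symm
  refine Finset.sum_bij (fun p _ => Function.update x p.1 p.2) ?_ ?_ ?_ (fun _ _ => rfl)
  · rintro ⟨i, z⟩ hp
    simp only [Finset.mem_filter, Finset.mem_univ, true_and] at hp ⊢
    exact gridGraphD_adj_iff.mpr ⟨i, z, hp, rfl⟩
  · rintro ⟨i, z⟩ hp ⟨i', z'⟩ hp' heq
    simp only [Finset.mem_filter, Finset.mem_univ, true_and] at hp hp' heq
    have hne : z ≠ x i := fun h => by rw [h] at hp; omega
    have hi : i = i' := by
      by_contra hii
      have := congrFun heq i
      rw [Function.update_self, Function.update_of_ne hii] at this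
      exact hne this
    subst hi
    have := congrFun heq i
    simp only [Function.update_self] at this
    rw [this]
  · intro y hy
    simp only [Finset.mem_filter, Finset.mem_univ, true_and] at hy
    obtain ⟨i, z, hz, rfl⟩ := gridGraphD_adj_iff.mp hy
    exact ⟨(i, z), by simpa using hz, rfl⟩

end Grid

theorem inv_sum_sq_le {d N : ℕ} (hd : 0 < d) (k : Fin d → Fin N) :
    (∑ i, ((k i : ℕ) : ℝ) ^ 2)⁻¹ ≤
      ∑ i, if ∀ l, k l ≤ k i then (((k i : ℕ) : ℝ) ^ 2)⁻¹ else 0 := by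
  have : Nonempty (Fin d) := ⟨⟨0, hd⟩⟩
  obtain ⟨i, hi⟩ := Finite.exists_max k
  have hle : (((k i : ℕ) : ℝ) ^ 2)⁻¹ ≤
      ∑ i, if ∀ l, k l ≤ k i then (((k i : ℕ) : ℝ) ^ 2)⁻¹ else 0 := by
    have h := Finset.single_le_sum
      (f := fun i => if ∀ l, k l ≤ k i then (((k i : ℕ) : ℝ) ^ 2)⁻¹ else 0)
      (fun j _ => by split_ifs <;> positivity) (Finset.mem_univ i)
    simpa only [if_pos hi] using h
  refine le_trans ?_ hle
  rcases Nat.eq_zero_or_pos (k i : ℕ) with h0 | hpos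
  · have hz : ∀ l, (k l : ℕ) = 0 := fun l => by
      have : (k l : ℕ) ≤ k i := hi l
      omega
    simp [hz]
  · have : (0 : ℝ) < (k i : ℕ) := by exact_mod_cast hpos
    gcongr
    exact Finset.single_le_sum (f := fun i => ((k i : ℕ) : ℝ) ^ 2)
      (fun j _ => sq_nonneg _) (Finset.mem_univ i)

theorem card_filter_eq_and_forall_le {d N : ℕ} (i : Fin d) (r : Fin N) :
    (Finset.univ.filter fun k : Fin d → Fin N => k i = r ∧ ∀ l, k l ≤ r).card ≤
      ((r : ℕ) + 1) ^ (d - 1) := by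
  classical
  have hsub : (Finset.univ.filter fun k : Fin d → Fin N => k i = r ∧ ∀ l, k l ≤ r) ⊆
      Fintype.piFinset fun l => if l = i then {r} else Finset.Iic r := by
    intro k hk
    simp only [Finset.mem_filter, Finset.mem_univ, true_and] at hk
    rw [Fintype.mem_piFinset]
    intro l
    split_ifs with h
    · rw [h, Finset.mem_singleton]; exact hk.1
    · exact Finset.mem_Iic.mpr (hk.2 l)
  refine (Finset.card_le_card hsub).trans ?_
  rw [Fintype.card_piFinset, ← Finset.mul_prod_erase _ _ (Finset.mem_univ i), if_pos rfl,
    Finset.card_singleton, one_mul, Finset.prod_congr rfl (g := fun _ => (r : ℕ) + 1)]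
  · simp
  · intro l hl
    rw [if_neg (Finset.ne_of_mem_erase hl), Fin.card_Iic]

theorem sum_inv_sum_sq_le {d N : ℕ} (hd : 3 ≤ d) :
    ∑ k : Fin d → Fin N, (∑ i, ((k i : ℕ) : ℝ) ^ 2)⁻¹ ≤ d * 2 ^ (d - 1) * (N : ℝ) ^ (d - 2) := by
  refine (Finset.sum_le_sum fun k _ => inv_sum_sq_le (by omega) k).trans ?_
  rw [Finset.sum_comm]
  have hi (i : Fin d) : (∑ k : Fin d → Fin N,
      if ∀ l, k l ≤ k i then (((k i : ℕ) : ℝ) ^ 2)⁻¹ else 0) ≤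
        2 ^ (d - 1) * (N : ℝ) ^ (d - 2) := by
    rw [← Finset.sum_fiberwise Finset.univ (fun k : Fin d → Fin N => k i)]
    have hr (r : Fin N) : (∑ k : Fin d → Fin N with k i = r,
        if ∀ l, k l ≤ k i then (((k i : ℕ) : ℝ) ^ 2)⁻¹ else 0) ≤
          2 ^ (d - 1) * (N : ℝ) ^ (d - 3) := by
      have h1 : (∑ k : Fin d → Fin N with k i = r,
          if ∀ l, k l ≤ k i then (((k i : ℕ) : ℝ) ^ 2)⁻¹ else 0) =
          (Finset.univ.filter fun k : Fin d → Fin N => k i = r ∧ ∀ l, k l ≤ r).card *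
            (((r : ℕ) : ℝ) ^ 2)⁻¹ := by
        rw [← nsmul_eq_mul, ← Finset.sum_const, ← Finset.filter_filter,
          Finset.sum_filter (fun k : Fin d → Fin N => ∀ l, k l ≤ r)]
        refine Finset.sum_congr rfl fun k hk => ?_
        rw [(Finset.mem_filter.mp hk).2]
      rw [h1]
      rcases Nat.eq_zero_or_pos (r : ℕ) with h0 | hpos
      · simp only [h0]
        norm_num
      · have hpos' : (1 : ℝ) ≤ (r : ℕ) := by exact_mod_cast hpos
        have hrN : ((r : ℕ) : ℝ) ≤ N := by exact_mod_cast r.2.le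
        have hc : ((Finset.univ.filter fun k : Fin d → Fin N => k i = r ∧ ∀ l, k l ≤ r).card : ℝ) ≤
              (((r : ℕ) : ℝ) + 1) ^ (d - 1) := by
          exact_mod_cast card_filter_eq_and_forall_le i r
        rw [← div_eq_mul_inv, div_le_iff₀ (by positivity)]
        calc _ ≤ (((r : ℕ) : ℝ) + 1) ^ (d - 1) := hc
          _ ≤ (2 * ((r : ℕ) : ℝ)) ^ (d - 1) := by gcongr; linarith
          _ = 2 ^ (d - 1) * ((r : ℕ) : ℝ) ^ (d - 3) * ((r : ℕ) : ℝ) ^ 2 := by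
            rw [mul_pow, mul_assoc, ← pow_add]; congr 2; omega
          _ ≤ _ := by gcongr
    refine (Finset.sum_le_sum fun r _ => hr r).trans ?_
    rw [Finset.sum_const, Finset.card_univ, Fintype.card_fin, nsmul_eq_mul]
    refine le_of_eq ?_
    rw [mul_left_comm, ← pow_succ']
    congr 2
    omega
  refine (Finset.sum_le_sum fun i _ => hi i).trans (le_of_eq ?_)
  rw [Finset.sum_const, Finset.card_univ, Fintype.card_fin, nsmul_eq_mul]
  ring

section GridModes

variable {d N : ℕ}

/-- Tensor products of cosine modes, as the rows of a matrix. -/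
def gridModes (d N : ℕ) : Matrix (Fin d → Fin N) (Fin d → Fin N) ℝ :=
  Matrix.of fun k x => ∏ i, cosMode N (k i) (x i)

/-- Eigenvalues of the Laplacian of the grid graph. -/
def gridEigenvalue (k : Fin d → Fin N) : ℝ :=
  ∑ i, (2 - 2 * Real.cos (Real.pi * (k i : ℕ) / N))

theorem gridModes_mul_transpose : gridModes d N * (gridModes d N)ᵀ = 1 := by
  ext k l
  have h1 (i : Fin d) : ∑ x : Fin N, cosMode N (k i) x * cosMode N (l i) x =
      if k i = l i then 1 else 0 := by
    rw [Fin.sum_univ_eq_sum_range fun x => cosMode N (k i) x * cosMode N (l i) x,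
      sum_cosMode_mul_cosMode (k i).2 (l i).2]
    simp only [Fin.ext_iff]
  simp only [Matrix.mul_apply, gridModes, transpose_apply, of_apply, ← Finset.prod_mul_distrib]
  rw [← Fintype.piFinset_univ, ← Finset.prod_univ_sum (fun _ : Fin d => Finset.univ)
    fun i (x : Fin N) => cosMode N (k i) x * cosMode N (l i) x,
    Finset.prod_congr rfl fun i _ => h1 i,
    Matrix.one_apply]
  split_ifs with h
  · subst h
    simp
  · obtain ⟨i, hi⟩ := Function.ne_iff.mp h
    exact Finset.prod_eq_zero (Finset.mem_univ i) (if_neg hi)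

theorem sum_sq_gridModes_mulVec (s : (Fin d → Fin N) → ℝ) :
    ∑ k, (gridModes d N *ᵥ s) k ^ 2 = ∑ x, s x ^ 2 := by
  have h : (gridModes d N *ᵥ s) ⬝ᵥ (gridModes d N *ᵥ s) = s ⬝ᵥ s := by
    rw [dotProduct_mulVec, ← mulVec_transpose, mulVec_mulVec,
      mul_eq_one_comm.mp gridModes_mul_transpose, one_mulVec]
  simpa only [dotProduct, ← sq] using h

theorem gridModes_sub_update (k x : Fin d → Fin N) (i : Fin d) (z : Fin N) :
    gridModes d N k x - gridModes d N k (Function.update x i z) =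
      (cosMode N (k i) (x i) - cosMode N (k i) z) *
        ∏ l ∈ Finset.univ.erase i, cosMode N (k l) (x l) := by
  simp only [gridModes, of_apply]
  rw [← Finset.mul_prod_erase _ _ (Finset.mem_univ i),
    ← Finset.mul_prod_erase _ (fun l => cosMode N (k l) (Function.update x i z l))
      (Finset.mem_univ i), Function.update_self, sub_mul]
  congr 2
  refine Finset.prod_congr rfl fun l hl => ?_
  rw [Function.update_of_ne (Finset.ne_of_mem_erase hl)]

open Classical in
/-- The tensor cosine modes are eigenvectors of the Laplacian of the grid graph. -/
theorem sum_gridModes_sub (k x : Fin d → Fin N) :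
    (∑ y, if (gridGraphD d N).Adj x y then gridModes d N k x - gridModes d N k y else 0) =
      gridEigenvalue k * gridModes d N k x := by
  rw [sum_gridGraphD_adj x fun y => gridModes d N k x - gridModes d N k y, gridEigenvalue,
    Finset.sum_mul]
  refine Finset.sum_congr rfl fun i _ => ?_
  simp only [gridModes_sub_update]
  have h1 := sum_cosMode_sub_cosMode (k i : ℕ) (x i).2
  rw [← Fin.sum_univ_eq_sum_range fun z => if z = (x i : ℕ) + 1 ∨ (x i : ℕ) = z + 1
    then cosMode N (k i) (x i) - cosMode N (k i) z else 0] at h1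
  have h2 : gridModes d N k x = cosMode N (k i) (x i) *
      ∏ l ∈ Finset.univ.erase i, cosMode N (k l) (x l) := by
    rw [Finset.mul_prod_erase _ (fun l => cosMode N (k l) (x l)) (Finset.mem_univ i)]
    rfl
  rw [h2, ← mul_assoc, ← h1, Finset.sum_mul]
  exact Finset.sum_congr rfl fun z _ => by rw [ite_mul, zero_mul]

theorem four_div_sq_mul_sum_sq_le_gridEigenvalue (k : Fin d → Fin N) :
    4 / (N : ℝ) ^ 2 * ∑ i, ((k i : ℕ) : ℝ) ^ 2 ≤ gridEigenvalue k := by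
  rw [Finset.mul_sum]
  exact Finset.sum_le_sum fun i _ => sq_le_two_sub_two_mul_cos (k i).2

theorem gridModes_sub_sq_le {x y : Fin d → Fin N} (h : (gridGraphD d N).Adj x y)
    (k : Fin d → Fin N) :
    (gridModes d N k x - gridModes d N k y) ^ 2 ≤ (2 / N) ^ d * gridEigenvalue k := by
  obtain ⟨i, z, hz, rfl⟩ := gridGraphD_adj_iff.mp h
  have hcos (l : Fin d) : 0 ≤ 2 - 2 * Real.cos (Real.pi * (k l : ℕ) / N) := by
    linarith [Real.cos_le_one (Real.pi * (k l : ℕ) / N)]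
  have h1 : (cosMode N (k i) (x i) - cosMode N (k i) z) ^ 2 ≤
      2 / N * (2 - 2 * Real.cos (Real.pi * (k i : ℕ) / N)) := by
    rcases hz with hz | hz
    · rw [hz]
      exact cosMode_sub_succ_sq_le N (k i) (x i)
    · rw [hz, ← neg_sub, neg_sq]
      exact cosMode_sub_succ_sq_le N (k i) z
  have h2 : (∏ l ∈ Finset.univ.erase i, cosMode N (k l) (x l)) ^ 2 ≤ (2 / (N : ℝ)) ^ (d - 1) := by
    rw [← Finset.prod_pow]
    refine (Finset.prod_le_prod (fun _ _ => sq_nonneg _)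
      fun l _ => cosMode_sq_le N (k l) (x l)).trans (le_of_eq ?_)
    rw [Finset.prod_const, Finset.card_erase_of_mem (Finset.mem_univ i), Finset.card_fin]
  have h3 : 2 - 2 * Real.cos (Real.pi * (k i : ℕ) / N) ≤ gridEigenvalue k :=
    Finset.single_le_sum (f := fun i => 2 - 2 * Real.cos (Real.pi * (k i : ℕ) / N))
      (fun l _ => hcos l) (Finset.mem_univ i)
  have hd : (2 / N : ℝ) ^ d = (2 / N) ^ (d - 1) * (2 / N) := by
    rw [← pow_succ, Nat.sub_add_cancel (by have := i.2; omega)]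
  rw [gridModes_sub_update, mul_pow]
  calc _ ≤ 2 / N * (2 - 2 * Real.cos (Real.pi * (k i : ℕ) / N)) * (2 / (N : ℝ)) ^ (d - 1) := by
        have := hcos i
        gcongr
    _ ≤ 2 / N * gridEigenvalue k * (2 / (N : ℝ)) ^ (d - 1) := by gcongr
    _ = (2 / N) ^ d * gridEigenvalue k := by
      rw [hd]
      ring

theorem gridModes_eq_of_forall_eq_zero {k : Fin d → Fin N} (hk : ∀ i, (k i : ℕ) = 0)
    (x y : Fin d → Fin N) : gridModes d N k x = gridModes d N k y := by
  simp [gridModes, hk, cosMode]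

end GridModes

theorem gridModes_mulVec_pseudoinverse_col_sq_le {d N m : ℕ}
    {D : Matrix (Fin m) (Fin d → Fin N) ℝ} {S : Matrix (Fin d → Fin N) (Fin m) ℝ}
    (hD : IsIncidence (gridGraphD d N) D) (hS : IsMoorePenrose D S) (j : Fin m)
    (k : Fin d → Fin N) :
    (gridModes d N *ᵥ Sᵀ j) k ^ 2 ≤
      (2 / N) ^ d * ((N : ℝ) ^ 2 / 4) * (∑ i, ((k i : ℕ) : ℝ) ^ 2)⁻¹ := by
  classical
  obtain ⟨a, b, hab, -, -, -, hv⟩ := hD.exists_mulVec_eq j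
  have hdot : (gridModes d N *ᵥ Sᵀ j) k = (Sᵀ *ᵥ gridModes d N k) j := dotProduct_comm _ _
  rw [hdot]
  by_cases hk : ∀ i, (k i : ℕ) = 0
  · have hDk : D *ᵥ gridModes d N k = 0 := by
      funext e
      obtain ⟨a, b, -, -, -, -, hv⟩ := hD.exists_mulVec_eq e
      rw [hv, gridModes_eq_of_forall_eq_zero hk a b, sub_self, Pi.zero_apply]
    rw [hS.transpose_mulVec_eq_zero hDk]
    simp [hk]
  · have hgram : (Dᵀ * D) *ᵥ gridModes d N k = gridEigenvalue k • gridModes d N k := by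
      funext x
      rw [hD.gram_mulVec, sum_gridModes_sub, Pi.smul_apply, smul_eq_mul]
    have heq : gridEigenvalue k * (Sᵀ *ᵥ gridModes d N k) j =
        gridModes d N k a - gridModes d N k b := by
      have h := congrFun (hS.transpose_mulVec_gram (gridModes d N k)) j
      rwa [hgram, mulVec_smul, Pi.smul_apply, smul_eq_mul, hv] at h
    push Not at hk
    obtain ⟨i, hi⟩ := hk
    have hN : (0 : ℝ) < N := by
      have := (k i).2
      exact_mod_cast (by omega : 0 < N)
    have hsum : 0 < ∑ i, ((k i : ℕ) : ℝ) ^ 2 :=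
      Finset.sum_pos' (fun _ _ => sq_nonneg _) ⟨i, Finset.mem_univ i, by positivity⟩
    have hlow := four_div_sq_mul_sum_sq_le_gridEigenvalue k
    have hpos : 0 < gridEigenvalue k := lt_of_lt_of_le (by positivity) hlow
    have hle := gridModes_sub_sq_le hab k
    rw [← heq, mul_pow, sq (gridEigenvalue k), mul_assoc, mul_comm (_ ^ d)] at hle
    have hle' := le_of_mul_le_mul_left hle hpos
    calc _ ≤ (2 / N : ℝ) ^ d * (gridEigenvalue k)⁻¹ := by
          rw [← div_eq_mul_inv, le_div_iff₀ hpos, mul_comm]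
          exact hle'
      _ ≤ (2 / N : ℝ) ^ d * (4 / (N : ℝ) ^ 2 * ∑ i, ((k i : ℕ) : ℝ) ^ 2)⁻¹ := by gcongr
      _ = _ := by rw [mul_inv, inv_div, mul_assoc]

/-- Proposition 3.3: for every `d ≥ 3` there is a constant
`C(d) > 0` such that, uniformly in `N ≥ 2`, every column of the Moore–Penrose
pseudoinverse of the incidence matrix of the d-dimensional grid on `N^d`
vertices has Euclidean norm at most `C(d)`. -/
theorem gridd_inverse_scaling_factor :
    ∀ d : ℕ, 3 ≤ d → ∃ C : ℝ, 0 < C ∧ ∀ N : ℕ, 2 ≤ N →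
      ∀ (m : ℕ) (D : Matrix (Fin m) (Fin d → Fin N) ℝ),
        IsIncidence (gridGraphD d N) D →
        ∀ S : Matrix (Fin d → Fin N) (Fin m) ℝ, IsMoorePenrose D S →
          ∀ j : Fin m, colNorm S j ≤ C := by
  intro d hd
  have hd0 : (0 : ℝ) < d := by exact_mod_cast (by omega : 0 < d)
  refine ⟨√(2 ^ d * 2 ^ (d - 1) * d / 4), by positivity, fun N hN m D hD S hS j =>
    Real.sqrt_le_sqrt ?_⟩
  have hN0 : (0 : ℝ) < N := by exact_mod_cast (by omega : 0 < N)
  have hNd : (N : ℝ) ^ d = N ^ 2 * N ^ (d - 2) := by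
    rw [← pow_add]
    congr 1
    omega
  calc ∑ i, S i j ^ 2 = ∑ k, (gridModes d N *ᵥ Sᵀ j) k ^ 2 :=
        (sum_sq_gridModes_mulVec (Sᵀ j)).symm
    _ ≤ ∑ k : Fin d → Fin N,
        (2 / N) ^ d * ((N : ℝ) ^ 2 / 4) * (∑ i, ((k i : ℕ) : ℝ) ^ 2)⁻¹ :=
      Finset.sum_le_sum fun k _ => gridModes_mulVec_pseudoinverse_col_sq_le hD hS j k
    _ ≤ (2 / N) ^ d * ((N : ℝ) ^ 2 / 4) * (d * 2 ^ (d - 1) * (N : ℝ) ^ (d - 2)) := by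
      rw [← Finset.mul_sum]
      gcongr
      exact sum_inv_sum_sq_le hd
    _ = 2 ^ d * 2 ^ (d - 1) * d / 4 := by
      rw [div_pow, hNd]
      field_simp
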